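/- arXiv:1611.02664 — 2 statements merged into one kernel-verified Lean document; each statement's English description precedes it below -/
import Mathlib

section
/- Under the process filtering setup, for each index n with 1 ≤ n ≤ D and each t > 0, almost surely E[ 1{H = E_n} | 𝓕_t ] = p_n exp(σ E_n ξ_t − (σ²/2) E_n² t) / Σ_{r=1}^D p_r exp(σ E_r ξ_t − (σ²/2) E_r² t); that is, the conditional probability of the event {H = E_n} given the whole observed path (ξ_s)_{s ≤ t} depends only on the current value ξ_t, through the stated Bayes formula. -/
open MeasureTheory ProbabilityTheory Filter

/-- `B` is a Brownian motion under `μ`, in the sense of finite-dimensional laws, whose increments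
are independent of the σ-algebra `m` joined with the past of `B`. -/
structure IsBrownianOver {Ω : Type*} (m : MeasurableSpace Ω) {mΩ : MeasurableSpace Ω}
    (B : ℝ → Ω → ℝ) (μ : Measure Ω) : Prop where
  measurable (s : ℝ) : Measurable (B s)
  zero (ω : Ω) : B 0 ω = 0
  map_sub (s t : ℝ) (hs : 0 ≤ s) (hst : s ≤ t) :
    μ.map (fun ω => B t ω - B s ω) = gaussianReal 0 (t - s).toNNReal
  indep_sub (s t : ℝ) (hs : 0 ≤ s) (hst : s ≤ t) :
    Indep (MeasurableSpace.comap (fun ω => B t ω - B s ω) Real.measurableSpace)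
      (m ⊔ ⨆ u ∈ Set.Icc (0 : ℝ) s, MeasurableSpace.comap (B u) Real.measurableSpace) μ

namespace IsBrownianOver

variable {Ω : Type*} {m mΩ : MeasurableSpace Ω} {μ : Measure Ω} {B : ℝ → Ω → ℝ}

lemma measurable_past {a u : ℝ} (hu : u ∈ Set.Icc 0 a) :
    Measurable[m ⊔ ⨆ u ∈ Set.Icc (0 : ℝ) a, MeasurableSpace.comap (B u) Real.measurableSpace]
      (B u) := by
  refine measurable_iff_comap_le.2 (le_sup_of_le_right ?_)
  exact le_iSup₂_of_le u hu le_rfl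

lemma past_le (hB : IsBrownianOver m B μ) (hm : m ≤ mΩ) (a : ℝ) :
    m ⊔ ⨆ u ∈ Set.Icc (0 : ℝ) a, MeasurableSpace.comap (B u) Real.measurableSpace ≤ mΩ :=
  sup_le hm (iSup₂_le fun u _ => (hB.measurable u).comap_le)

lemma integral_mul_cexp_sub (hB : IsBrownianOver m B μ) (hm : m ≤ mΩ) {a b : ℝ} (ha : 0 ≤ a)
    (hab : a ≤ b) {f : Ω → ℂ}
    (hf : Measurable[m ⊔ ⨆ u ∈ Set.Icc (0 : ℝ) a,
      MeasurableSpace.comap (B u) Real.measurableSpace] f) (w : ℂ) :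
    ∫ ω, f ω * Complex.exp (w * ((B b ω - B a ω : ℝ) : ℂ)) ∂μ
      = (∫ ω, f ω ∂μ) * Complex.exp (w ^ 2 * (b - a) / 2) := by
  have hexp : Measurable fun x : ℝ => Complex.exp (w * x) := by fun_prop
  have hind : IndepFun f (fun ω => Complex.exp (w * ((B b ω - B a ω : ℝ) : ℂ))) μ := by
    rw [IndepFun_iff_Indep]
    refine indep_of_indep_of_le_left (indep_of_indep_of_le_right (hB.indep_sub a b ha hab).symm ?_)
      hf.comap_le
    exact (hexp.comp (comap_measurable _)).comap_le
  have hBm : ∀ s, Measurable (B s) := hB.measurable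
  rw [hind.integral_fun_mul_eq_mul_integral (hf.mono (hB.past_le hm a) le_rfl).aestronglyMeasurable
    (hexp.comp ((hBm b).sub (hBm a))).aestronglyMeasurable]
  congr 1
  have := complexMGF_gaussianReal (hB.map_sub a b ha hab) w
  rw [complexMGF] at this
  rw [this, Real.coe_toNNReal _ (sub_nonneg.2 hab)]
  congr 1
  push_cast
  ring

/-- The exponential moments of the finite-dimensional laws, with complex exponents. -/
lemma integral_mul_cexp_sum (hB : IsBrownianOver m B μ) (hm : m ≤ mΩ) {g : Ω → ℂ}
    (hg : Measurable[m] g) {t : ℝ} (z : Set.Icc (0 : ℝ) t → ℂ) (J : Finset (Set.Icc (0 : ℝ) t)) :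
    ∀ (b : ℝ) (w : ℂ), 0 ≤ b → (∀ s ∈ J, (s : ℝ) ≤ b) →
      ∫ ω, g ω * Complex.exp (w * B b ω + ∑ s ∈ J, z s * B s ω) ∂μ
        = (∫ ω, g ω ∂μ) * Complex.exp ((w ^ 2 * b + 2 * w * ∑ s ∈ J, z s * (s : ℝ)
          + ∑ s ∈ J, ∑ u ∈ J, z s * z u * (min (s : ℝ) u : ℝ)) / 2) := by
  induction J using Finset.induction_on_max with
  | empty =>
    intro b w hb _
    have := hB.integral_mul_cexp_sub hm le_rfl hb (hg.mono le_sup_left le_rfl) w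
    simpa [hB.zero] using this
  | insert a J hJ ih =>
    intro b w hb hJb
    have ha : a ∉ J := fun h => lt_irrefl _ (hJ a h)
    have hab : (a : ℝ) ≤ b := hJb a (Finset.mem_insert_self _ _)
    have hmeas : Measurable[m ⊔ ⨆ u ∈ Set.Icc (0 : ℝ) a,
        MeasurableSpace.comap (B u) Real.measurableSpace]
        (fun ω => g ω * Complex.exp ((w + z a) * B a ω + ∑ s ∈ J, z s * B s ω)) := by
      have hpast : ∀ s ∈ insert a J, Measurable[m ⊔ ⨆ u ∈ Set.Icc (0 : ℝ) a,
          MeasurableSpace.comap (B u) Real.measurableSpace] (fun ω => (B s ω : ℂ)) := by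
        intro s hs
        refine Complex.measurable_ofReal.comp (measurable_past ⟨s.2.1, ?_⟩)
        rcases Finset.mem_insert.1 hs with rfl | hs
        · exact le_rfl
        · exact (hJ s hs).le
      refine (hg.mono le_sup_left le_rfl).mul (Complex.measurable_exp.comp ?_)
      refine ((hpast a (Finset.mem_insert_self _ _)).const_mul _).add ?_
      exact Finset.measurable_fun_sum J fun s hs =>
        (hpast s (Finset.mem_insert_of_mem hs)).const_mul _
    have hstep := hB.integral_mul_cexp_sub hm a.2.1 hab hmeas w
    rw [ih a (w + z a) a.2.1 fun s hs => (hJ s hs).le] at hstep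
    calc _ = ∫ ω, g ω * Complex.exp ((w + z a) * B a ω + ∑ s ∈ J, z s * B s ω) *
            Complex.exp (w * ((B b ω - B a ω : ℝ) : ℂ)) ∂μ := by
          congr 1 with ω
          rw [mul_assoc, ← Complex.exp_add, Finset.sum_insert ha]
          congr 2
          push_cast
          ring
      _ = _ := by
          rw [hstep, mul_assoc, ← Complex.exp_add]
          congr 2
          have h1 : ∑ u ∈ J, z a * z u * (min (a : ℝ) u : ℝ) = z a * ∑ s ∈ J, z s * (s : ℝ) := by
            rw [Finset.mul_sum]
            refine Finset.sum_congr rfl fun u hu => ?_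
            rw [min_eq_right (show (u : ℝ) ≤ a from (hJ u hu).le)]
            ring
          have h2 : ∑ s ∈ J, z s * z a * (min (s : ℝ) a : ℝ) = z a * ∑ s ∈ J, z s * (s : ℝ) := by
            rw [Finset.mul_sum]
            refine Finset.sum_congr rfl fun u hu => ?_
            rw [min_eq_left (show (u : ℝ) ≤ a from (hJ u hu).le)]
            ring
          simp only [Finset.sum_insert ha, Finset.sum_add_distrib, h1, h2, min_self]
          ring

lemma integrable_exp (hB : IsBrownianOver m B μ) {t : ℝ} (ht : 0 ≤ t) (c d : ℝ) :
    Integrable (fun ω => Real.exp (c * B t ω - d)) μ := by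
  have hBm := hB.measurable t
  have hlaw : μ.map (B t) = gaussianReal 0 t.toNNReal := by
    simpa [hB.zero] using hB.map_sub 0 t le_rfl ht
  have h := integrable_exp_mul_gaussianReal (μ := 0) (v := t.toNNReal) c
  rw [← hlaw, integrable_map_measure (by fun_prop) hBm.aemeasurable] at h
  simpa [Function.comp_def, Real.exp_sub, div_eq_mul_inv] using h.mul_const (Real.exp d)⁻¹

/-- Cameron-Martin formula for a constant drift: adding the drift `c` to the path of `B` on `[0, t]`
amounts to reweighting the law by `exp (c * B t - c ^ 2 / 2 * t)`, independently of `m`. -/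
theorem map_restrict_add_drift [IsProbabilityMeasure μ] (hB : IsBrownianOver m B μ) (hm : m ≤ mΩ)
    {t : ℝ} (ht : 0 ≤ t) (c : ℝ) {A : Set Ω} (hA : MeasurableSet[m] A) :
    (μ.restrict A).map (fun ω (s : Set.Icc (0 : ℝ) t) => c * s + B s ω)
      = μ A • (μ.withDensity fun ω => ENNReal.ofReal (Real.exp (c * B t ω - c ^ 2 / 2 * t))).map
        (fun ω (s : Set.Icc (0 : ℝ) t) => B s ω) := by
  have hBm : ∀ s, Measurable (B s) := hB.measurable
  have hfin : IsFiniteMeasure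
      (μ.withDensity fun ω => ENNReal.ofReal (Real.exp (c * B t ω - c ^ 2 / 2 * t))) :=
    isFiniteMeasure_withDensity_ofReal (hB.integrable_exp ht _ _).2
  have hfin' := Measure.smul_finite
    ((μ.withDensity fun ω => ENNReal.ofReal (Real.exp (c * B t ω - c ^ 2 / 2 * t))).map
        (fun ω (s : Set.Icc (0 : ℝ) t) => B s ω)) (measure_ne_top μ A)
  refine IsProjectiveLimit.unique (P := fun J => Measure.map J.restrict _)
    (fun J => ?_) (fun J => rfl)
  refine Measure.ext_of_charFunDual ?_
  ext L
  let z : Set.Icc (0 : ℝ) t → ℂ := fun s =>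
    if h : s ∈ J then L (Pi.single ⟨s, h⟩ 1) * Complex.I else 0
  have hz : ∀ y : Set.Icc (0 : ℝ) t → ℝ,
      (L (J.restrict y) : ℂ) * Complex.I = ∑ s ∈ J, z s * y s := by
    intro y
    have : L (J.restrict y) = ∑ i : J, y i * L (Pi.single i 1) := by
      conv_lhs => rw [← Finset.univ_sum_single (J.restrict y), map_sum]
      refine Finset.sum_congr rfl fun i _ => ?_
      rw [← smul_eq_mul, ← map_smul, ← Pi.single_smul]
      simp
    rw [this, ← Finset.sum_coe_sort J, Complex.ofReal_sum, Finset.sum_mul]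
    refine Finset.sum_congr rfl fun i _ => ?_
    simp only [z, Finset.coe_mem, dif_pos, Complex.ofReal_mul]
    ring
  have hJm : Measurable (J.restrict : (Set.Icc (0 : ℝ) t → ℝ) → J → ℝ) :=
    Finset.measurable_restrict J
  have hpath : Measurable fun ω (s : Set.Icc (0 : ℝ) t) => B s ω := by fun_prop
  have hdrift : Measurable fun ω (s : Set.Icc (0 : ℝ) t) => c * s + B s ω := by fun_prop
  have hLm : Measurable fun v : J → ℝ => Complex.exp (L v * Complex.I) := by fun_prop
  beta_reduce
  rw [charFunDual_apply, charFunDual_apply, Measure.map_smul, integral_smul_measure,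
    Measure.map_map hJm hdrift, Measure.map_map hJm hpath,
    integral_map (hJm.comp hdrift).aemeasurable hLm.aestronglyMeasurable,
    integral_map (hJm.comp hpath).aemeasurable hLm.aestronglyMeasurable,
    integral_withDensity_eq_integral_toReal_smul (by fun_prop) (by simp)]
  simp only [Function.comp_apply, hz]
  have hleft := hB.integral_mul_cexp_sum hm
    (g := A.indicator 1) ((@measurable_one _ _ _ m _).indicator hA) z J t 0 ht fun s _ => s.2.2
  have hright := hB.integral_mul_cexp_sum hm (g := 1) (@measurable_one _ _ _ m _) z J t c ht fun s _ => s.2.2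
  have hAm : MeasurableSet A := hm A hA
  have hind : ∫ ω, A.indicator (1 : Ω → ℂ) ω ∂μ = (μ.real A : ℂ) := by
    simp [integral_indicator hAm]
  rw [hind] at hleft
  calc _ = (∫ ω, A.indicator 1 ω * Complex.exp (0 * B t ω + ∑ s ∈ J, z s * B s ω) ∂μ) *
        Complex.exp (c * ∑ s ∈ J, z s * (s : ℝ)) := by
        rw [← integral_mul_const, ← integral_indicator hAm]
        congr 1 with ω
        by_cases hω : ω ∈ A
        · simp only [hω, Set.indicator_of_mem, Pi.one_apply, one_mul, ← Complex.exp_add]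
          congr 1
          rw [Finset.mul_sum, zero_mul, zero_add, ← Finset.sum_add_distrib]
          refine Finset.sum_congr rfl fun s _ => ?_
          push_cast
          ring
        · simp [hω]
    _ = μ.real A * ((∫ ω, (1 : Ω → ℂ) ω * Complex.exp (c * B t ω + ∑ s ∈ J, z s * B s ω) ∂μ) *
        Complex.exp (-(c ^ 2 / 2 * t))) := by
        rw [hleft, hright]
        simp only [Pi.one_apply, integral_const, probReal_univ, one_smul, one_mul, mul_assoc,
          ← Complex.exp_add]
        congr 2
        ring
    _ = _ := by
        rw [← integral_mul_const, Complex.real_smul]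
        congr 2 with ω
        rw [ENNReal.toReal_ofReal (Real.exp_nonneg _), Complex.real_smul, Complex.ofReal_exp,
          ← Complex.exp_add, Pi.one_apply, one_mul, ← Complex.exp_add]
        congr 1
        push_cast
        ring

/-- Integrated form of the Cameron-Martin formula. -/
theorem setIntegral_comp_add_drift [IsProbabilityMeasure μ] (hB : IsBrownianOver m B μ)
    (hm : m ≤ mΩ) {t : ℝ} (ht : 0 ≤ t) (c : ℝ) {A : Set Ω} (hA : MeasurableSet[m] A)
    {h : (Set.Icc (0 : ℝ) t → ℝ) → ℝ} (hh : Measurable h) :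
    ∫ ω in A, h (fun s => c * s + B s ω) ∂μ
      = μ.real A * ∫ ω, Real.exp (c * B t ω - c ^ 2 / 2 * t) * h (fun s => B s ω) ∂μ := by
  have hBm : ∀ s, Measurable (B s) := hB.measurable
  have hpath : Measurable fun ω (s : Set.Icc (0 : ℝ) t) => B s ω := by fun_prop
  have hdrift : Measurable fun ω (s : Set.Icc (0 : ℝ) t) => c * s + B s ω := by fun_prop
  rw [← integral_map hdrift.aemeasurable hh.aestronglyMeasurable,
    hB.map_restrict_add_drift hm ht c hA, integral_smul_measure,
    integral_map hpath.aemeasurable hh.aestronglyMeasurable,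
    integral_withDensity_eq_integral_toReal_smul (by fun_prop) (by simp)]
  simp only [ENNReal.toReal_ofReal (Real.exp_nonneg _), smul_eq_mul, measureReal_def]

end IsBrownianOver

/-- Process filtering: the conditional probability of `{H = E n}` given the path
filtration `𝓕 t` generated by the information process depends only on `ξ t`,
through the Bayes formula. -/
theorem conditional_probability_given_information_filtration
    {Ω : Type*} [MeasureSpace Ω] (hP : IsProbabilityMeasure (ℙ : Measure Ω))
    (D : ℕ) (hD : 1 ≤ D) (E : Fin D → ℝ) (hE : Function.Injective E)
    (σ : ℝ) (hσ : 0 < σ)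
    (H : Ω → ℝ) (hH : Measurable H) (hHval : ∀ ω, ∃ r, H ω = E r)
    (p : Fin D → ℝ) (hp : ∀ r, p r = ((ℙ : Measure Ω) {ω | H ω = E r}).toReal)
    (B : ℝ → Ω → ℝ) (hBmeas : ∀ s, Measurable (B s)) (hB0 : ∀ ω, B 0 ω = 0)
    (hBlaw : ∀ s t : ℝ, 0 ≤ s → s ≤ t →
      Measure.map (fun ω => B t ω - B s ω) (ℙ : Measure Ω)
        = gaussianReal 0 (t - s).toNNReal)
    (hBindep : ∀ s t : ℝ, 0 ≤ s → s ≤ t →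
      Indep (MeasurableSpace.comap (fun ω => B t ω - B s ω) Real.measurableSpace)
        (MeasurableSpace.comap H Real.measurableSpace ⊔
          ⨆ u ∈ Set.Icc (0 : ℝ) s, MeasurableSpace.comap (B u) Real.measurableSpace)
        (ℙ : Measure Ω))
    (ξ : ℝ → Ω → ℝ) (hξ : ∀ s ω, ξ s ω = σ * s * H ω + B s ω)
    (F : ℝ → MeasurableSpace Ω)
    (hF : ∀ t, F t =
      ⨆ s ∈ Set.Icc (0 : ℝ) t, MeasurableSpace.comap (ξ s) Real.measurableSpace)
    (n : Fin D) (t : ℝ) (ht : 0 < t) :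
    (ℙ : Measure Ω)[(fun ω => if H ω = E n then (1 : ℝ) else 0) | F t]
      =ᵐ[(ℙ : Measure Ω)] fun ω =>
        p n * Real.exp (σ * E n * ξ t ω - σ ^ 2 / 2 * (E n) ^ 2 * t) /
          ∑ r, p r * Real.exp (σ * E r * ξ t ω - σ ^ 2 / 2 * (E r) ^ 2 * t) := by
  have hm : MeasurableSpace.comap H Real.measurableSpace ≤ MeasureSpace.toMeasurableSpace :=
    hH.comap_le
  have hB : IsBrownianOver (MeasurableSpace.comap H Real.measurableSpace) B (ℙ : Measure Ω) :=
    ⟨hBmeas, hB0, hBlaw, hBindep⟩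
  have hHset : ∀ r, MeasurableSet[MeasurableSpace.comap H Real.measurableSpace]
      {ω | H ω = E r} := fun r => ⟨{E r}, measurableSet_singleton _, rfl⟩
  have hunion : (⋃ r, {ω | H ω = E r}) = Set.univ :=
    Set.eq_univ_of_forall fun ω => Set.mem_iUnion.2 (hHval ω)
  have hξmeas : ∀ s, Measurable (ξ s) := fun s => by
    rw [funext (hξ s)]
    exact (hH.const_mul _).add (hBmeas s)
  let L : Fin D → ℝ → ℝ := fun r x => Real.exp (σ * E r * x - σ ^ 2 / 2 * (E r) ^ 2 * t)
  let φ : ℝ → ℝ := fun x => p n * L n x / ∑ r, p r * L r x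
  have hφmeas : Measurable φ := by fun_prop
  have hp0 : ∀ r, 0 ≤ p r := fun r => by rw [hp]; exact ENNReal.toReal_nonneg
  have hterm : ∀ x r, 0 ≤ p r * L r x := fun x r => mul_nonneg (hp0 r) (Real.exp_nonneg _)
  have hpos : ∀ x, 0 < ∑ r, p r * L r x := by
    intro x
    refine Finset.sum_pos' (fun r _ => hterm x r) ?_
    by_contra! hcon
    have hnull : ∀ r, (ℙ : Measure Ω) {ω | H ω = E r} = 0 := fun r => by
      have h0 : p r = 0 := by
        by_contra hne
        exact absurd (hcon r (Finset.mem_univ r))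
          (not_le.2 (mul_pos (lt_of_le_of_ne (hp0 r) (Ne.symm hne)) (Real.exp_pos _)))
      rw [hp, ENNReal.toReal_eq_zero_iff] at h0
      exact h0.resolve_right (measure_ne_top _ _)
    have := measure_iUnion_null hnull
    rw [hunion, measure_univ] at this
    exact one_ne_zero this
  have hφ0 : ∀ x, 0 ≤ φ x := fun x => div_nonneg (hterm x n) (hpos x).le
  have hφ1 : ∀ x, φ x ≤ 1 := fun x => (div_le_one (hpos x)).2
    (Finset.single_le_sum (f := fun r => p r * L r x) (fun r _ => hterm x r) (Finset.mem_univ n))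
  have hpathF : F t = MeasurableSpace.comap (fun ω (s : Set.Icc (0 : ℝ) t) => ξ s ω)
      MeasurableSpace.pi := by
    rw [hF, MeasurableSpace.pi, MeasurableSpace.comap_iSup, iSup_subtype']
    simp only [MeasurableSpace.comap_comp]
    rfl
  have hFle : F t ≤ MeasureSpace.toMeasurableSpace := by
    rw [hF]
    exact iSup₂_le fun s _ => (hξmeas s).comap_le
  have hξF : Measurable[F t] (ξ t) := by
    rw [hF]
    exact measurable_iff_comap_le.2 (le_iSup₂_of_le t ⟨ht.le, le_rfl⟩ le_rfl)
  -- On `{H = E r}` the path of `ξ` is that of `B` with constant drift `σ * E r`.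
  have hBayes : ∀ (r : Fin D) (h : (Set.Icc (0 : ℝ) t → ℝ) → ℝ), Measurable h →
      ∫ ω in {ω | H ω = E r}, h (fun s => ξ s ω)
        = ∫ ω, p r * L r (B t ω) * h (fun s => B s ω) := by
    intro r h hh
    simp only [mul_assoc]
    rw [integral_const_mul, hp, ← measureReal_def]
    have key := hB.setIntegral_comp_add_drift hm ht.le (σ * E r) (hHset r) hh
    simp only [mul_pow] at key
    calc _ = ∫ ω in {ω | H ω = E r}, h (fun s => σ * E r * s + B s ω) := by
          refine setIntegral_congr_fun (hm _ (hHset r)) fun ω hω => ?_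
          have hω' : H ω = E r := hω
          simp only [hξ, hω']
          congr 1 with s
          ring
      _ = _ := by
          rw [key]
          congr 2 with ω
          simp only [L]
          congr 3
          ring
  have hbdd : ∀ r (h : (Set.Icc (0 : ℝ) t → ℝ) → ℝ), Measurable h → (∀ x, ‖h x‖ ≤ 1) →
      Integrable (fun ω => p r * L r (B t ω) * h (fun s => B s ω)) (ℙ : Measure Ω) := by
    intro r h hh hle
    refine ((hB.integrable_exp ht.le (σ * E r) _).const_mul (p r)).mul_bdd (c := 1)
      (hh.comp (by fun_prop)).aestronglyMeasurable (ae_of_all _ fun ω => hle _)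
  symm
  refine ae_eq_condExp_of_forall_setIntegral_eq hFle ?_ ?_ ?_ ?_
  · exact ((integrable_const (1 : ℝ)).indicator (hm _ (hHset n))).congr
      (ae_of_all _ fun ω => by simp [Set.indicator_apply])
  · intro s _ _
    refine (Integrable.of_bound (C := 1) (hφmeas.comp (hξmeas t)).aestronglyMeasurable
      (ae_of_all _ fun ω => ?_)).integrableOn
    rw [Function.comp_apply, Real.norm_of_nonneg (hφ0 _)]
    exact hφ1 _
  · intro s hs _
    rw [hpathF] at hs
    obtain ⟨C, hC, rfl⟩ := hs
    have hX : Measurable fun ω (s : Set.Icc (0 : ℝ) t) => ξ s ω := by fun_prop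
    let ψ : (Set.Icc (0 : ℝ) t → ℝ) → ℝ := C.indicator fun y => φ (y ⟨t, ht.le, le_rfl⟩)
    have hψmeas : Measurable ψ := (hφmeas.comp (measurable_pi_apply _)).indicator hC
    have hψ1 : ∀ y, ‖ψ y‖ ≤ 1 := fun y => by
      refine (norm_indicator_le_norm_self _ _).trans ?_
      rw [Real.norm_of_nonneg (hφ0 _)]
      exact hφ1 _
    have hdisj : Pairwise (Function.onFun Disjoint fun r => {ω | H ω = E r}) := by
      intro i j hij
      refine Set.disjoint_left.2 fun ω (hi : H ω = E i) (hj : H ω = E j) => hij (hE ?_)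
      rw [← hi, hj]
    calc ∫ ω in (fun ω (s : Set.Icc (0 : ℝ) t) => ξ s ω) ⁻¹' C, φ (ξ t ω)
        = ∫ ω, ψ (fun s => ξ s ω) := by
          rw [← integral_indicator (hX hC)]
          rfl
      _ = ∑ r, ∫ ω in {ω | H ω = E r}, ψ (fun s => ξ s ω) := by
          rw [← setIntegral_univ, ← hunion]
          exact integral_iUnion_fintype (fun r => hm _ (hHset r)) hdisj fun r =>
            (Integrable.of_bound (C := 1) (hψmeas.comp hX).aestronglyMeasurable
              (ae_of_all _ fun ω => hψ1 _)).integrableOn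
      _ = ∫ ω, ∑ r, p r * L r (B t ω) * ψ (fun s => B s ω) := by
          rw [integral_finsetSum _ fun r _ => hbdd r ψ hψmeas hψ1]
          exact Finset.sum_congr rfl fun r _ => hBayes r ψ hψmeas
      _ = ∫ ω, p n * L n (B t ω) * C.indicator 1 (fun s : Set.Icc (0 : ℝ) t => B s ω) := by
          congr 1 with ω
          rw [← Finset.sum_mul]
          by_cases hω : (fun s : Set.Icc (0 : ℝ) t => B s ω) ∈ C
          · simp only [ψ, hω, Set.indicator_of_mem, Pi.one_apply, mul_one]
            exact mul_div_cancel₀ _ (hpos _).ne'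
          · simp [ψ, hω]
      _ = ∫ ω in {ω | H ω = E n}, C.indicator 1 (fun s : Set.Icc (0 : ℝ) t => ξ s ω) :=
          (hBayes n _ (measurable_one.indicator hC)).symm
      _ = _ := by
          rw [← integral_indicator (hX hC), ← integral_indicator (hm _ (hHset n))]
          congr 1 with ω
          by_cases hω : H ω = E n <;>
            by_cases hωC : (fun s : Set.Icc (0 : ℝ) t => ξ s ω) ∈ C <;>
              simp [Set.indicator, hω, hωC]
  · exact (hφmeas.comp hξF).aestronglyMeasurable
end

section
/- Under the process filtering setup, for any indices n, m, define Φ_{nm}(t, x) := exp((σ/2)(E_n + E_m) x − (σ²/4)(E_n² + E_m²) t) / Σ_{r=1}^D p_r exp(σ E_r x − (σ²/2) E_r² t). Then for all 0 ≤ s ≤ t, almost surely E[ Φ_{nm}(t, ξ_t) | 𝓕_s ] = exp(−(σ²/8)(E_n − E_m)² (t − s)) · Φ_{nm}(s, ξ_s). In particular, for n ≠ m the process (Φ_{nm}(t, ξ_t))_{t ≥ 0} is a strictly positive supermartingale whose expectation tends to 0 as t → ∞, i.e. a potential. -/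
open MeasureTheory ProbabilityTheory Filter
open scoped ENNReal NNReal

section CameronMartin

/-- The Cameron–Martin shift identity for a centred real Gaussian measure. -/
lemma lintegral_exp_mul_comp_add_gaussianReal (v : ℝ≥0) (a : ℝ) {f : ℝ → ℝ≥0∞}
    (hf : Measurable f) :
    ∫⁻ y, ENNReal.ofReal (Real.exp (-a * y - a ^ 2 / 2 * v)) * f (a * v + y) ∂gaussianReal 0 v
      = ∫⁻ y, f y ∂gaussianReal 0 v := by
  rcases eq_or_ne v 0 with rfl | hv
  · rw [gaussianReal_zero_var, lintegral_dirac' _ (by fun_prop), lintegral_dirac' _ hf]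
    simp
  have hv' : (v : ℝ) ≠ 0 := by exact_mod_cast hv
  rw [gaussianReal_of_var_ne_zero _ hv,
    lintegral_withDensity_eq_lintegral_mul _ (measurable_gaussianPDF 0 v) (by fun_prop),
    lintegral_withDensity_eq_lintegral_mul _ (measurable_gaussianPDF 0 v) hf,
    ← lintegral_add_left_eq_self (gaussianPDF 0 v * f) (a * (v : ℝ))]
  refine lintegral_congr fun y => ?_
  simp only [Pi.mul_apply, ← mul_assoc]
  congr 1
  rw [gaussianPDF, gaussianPDF, ← ENNReal.ofReal_mul (gaussianPDFReal_nonneg _ _ _)]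
  congr 1
  rw [gaussianPDFReal, gaussianPDFReal, mul_assoc, ← Real.exp_add]
  congr 2
  field_simp
  ring

/-- The Laplace transform of a centred real Gaussian measure, as a lower integral. -/
lemma lintegral_exp_gaussianReal (v : ℝ≥0) (b c : ℝ) :
    ∫⁻ y, ENNReal.ofReal (Real.exp (b * y + c)) ∂gaussianReal 0 v
      = ENNReal.ofReal (Real.exp (b ^ 2 / 2 * v + c)) := by
  have h := lintegral_exp_mul_comp_add_gaussianReal v (-b) (f := fun _ => 1) measurable_const
  simp only [mul_one, lintegral_const, measure_univ, neg_neg, neg_sq] at h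
  calc ∫⁻ y, ENNReal.ofReal (Real.exp (b * y + c)) ∂gaussianReal 0 v
      = ∫⁻ y, ENNReal.ofReal (Real.exp (b ^ 2 / 2 * v + c))
          * ENNReal.ofReal (Real.exp (b * y - b ^ 2 / 2 * v)) ∂gaussianReal 0 v := by
        refine lintegral_congr fun y => ?_
        rw [← ENNReal.ofReal_mul (Real.exp_nonneg _), ← Real.exp_add]
        congr 2
        ring
    _ = _ := by rw [lintegral_const_mul _ (by fun_prop), h, mul_one]

/-- Conditionally on `U`, reweighting by the Girsanov density of an independent Gaussian
increment `Z` removes the drift `a * v`. -/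
lemma lintegral_girsanov_of_indepFun {Ω Ω' : Type*} [MeasurableSpace Ω] [MeasurableSpace Ω']
    {μ : Measure Ω} [IsProbabilityMeasure μ] {U : Ω → Ω'} (hU : Measurable U)
    {Z : Ω → ℝ} (hZ : Measurable Z) (hUZ : IndepFun U Z μ) {v : ℝ≥0}
    (hlaw : μ.map Z = gaussianReal 0 v) {Y : Ω' → ℝ≥0∞} (hY : Measurable Y)
    {a x : Ω' → ℝ} (ha : Measurable a) (hx : Measurable x) {g : ℝ → ℝ≥0∞} (hg : Measurable g) :
    ∫⁻ ω, Y (U ω) * (ENNReal.ofReal (Real.exp (-a (U ω) * Z ω - a (U ω) ^ 2 / 2 * v))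
        * g (x (U ω) + (a (U ω) * v + Z ω))) ∂μ
      = ∫⁻ ω, Y (U ω) * ∫⁻ y, g (x (U ω) + y) ∂gaussianReal 0 v ∂μ := by
  have hK : Measurable fun q : Ω' × ℝ => Y q.1 *
      (ENNReal.ofReal (Real.exp (-a q.1 * q.2 - a q.1 ^ 2 / 2 * v))
        * g (x q.1 + (a q.1 * v + q.2))) := by fun_prop
  have hL : Measurable fun u : Ω' => Y u * ∫⁻ y, g (x u + y) ∂gaussianReal 0 v :=
    hY.mul (Measurable.lintegral_prod_right' (f := fun q : Ω' × ℝ => g (x q.1 + q.2))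
      (by fun_prop))
  have : IsProbabilityMeasure (μ.map U) := Measure.isProbabilityMeasure_map hU.aemeasurable
  have hjoint := (indepFun_iff_map_prod_eq_prod_map_map hU.aemeasurable hZ.aemeasurable).1 hUZ
  rw [hlaw] at hjoint
  rw [← lintegral_map hL hU, ← lintegral_map hK (hU.prodMk hZ), hjoint,
    lintegral_prod _ hK.aemeasurable]
  refine lintegral_congr fun u => ?_
  dsimp only
  rw [lintegral_const_mul _ (by fun_prop)]
  congr 1
  exact lintegral_exp_mul_comp_add_gaussianReal v (a u) (f := fun z => g (x u + z)) (by fun_prop)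

end CameronMartin

/-- `B` is a Brownian motion for the filtration `G` on `[0, ∞)`, and the random drift `X` is
known to `G` from time `0` on. -/
structure IsBrownianWithDrift {Ω : Type*} [mΩ : MeasurableSpace Ω] (X : Ω → ℝ) (B : ℝ → Ω → ℝ)
    (G : ℝ → MeasurableSpace Ω) (μ : Measure Ω) : Prop where
  le : ∀ u, 0 ≤ u → G u ≤ mΩ
  mono : ∀ u v, 0 ≤ u → u ≤ v → G u ≤ G v
  drift : ∀ u, 0 ≤ u → Measurable[G u] X
  adapted : ∀ u, 0 ≤ u → Measurable[G u] (B u)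
  zero : ∀ ω, B 0 ω = 0
  law : ∀ u v, 0 ≤ u → u ≤ v →
    μ.map (fun ω => B v ω - B u ω) = gaussianReal 0 (v - u).toNNReal
  indep : ∀ u v, 0 ≤ u → u ≤ v →
    Indep (MeasurableSpace.comap (fun ω => B v ω - B u ω) Real.measurableSpace) (G u) μ

/-- The Girsanov density removing the drift `X` up to time `u`. -/
noncomputable def girsanovDensity {Ω : Type*} (X : Ω → ℝ) (B : ℝ → Ω → ℝ) (u : ℝ) (ω : Ω) :
    ℝ≥0∞ :=
  ENNReal.ofReal (Real.exp (-X ω * B u ω - X ω ^ 2 / 2 * u))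

/-- The information process: Brownian motion with random drift `X`. -/
def driftedPath {Ω : Type*} (X : Ω → ℝ) (B : ℝ → Ω → ℝ) (u : ℝ) (ω : Ω) : ℝ :=
  u * X ω + B u ω

/-- The σ-algebra generated by the information process up to time `t`. -/
@[reducible]
def infoFiltration {Ω : Type*} (X : Ω → ℝ) (B : ℝ → Ω → ℝ) (t : ℝ) : MeasurableSpace Ω :=
  ⨆ s ∈ Set.Icc (0 : ℝ) t, MeasurableSpace.comap (driftedPath X B s) Real.measurableSpace

namespace IsBrownianWithDrift

variable {Ω : Type*} [mΩ : MeasurableSpace Ω] {X : Ω → ℝ} {B : ℝ → Ω → ℝ}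
  {G : ℝ → MeasurableSpace Ω} {μ : Measure Ω}

lemma measurable_driftedPath (h : IsBrownianWithDrift X B G μ) {u : ℝ} (hu : 0 ≤ u) :
    Measurable[G u] (driftedPath X B u) := by
  have hX := h.drift u hu
  have hB := h.adapted u hu
  exact (hX.const_mul u).add hB

lemma measurable_girsanovDensity (h : IsBrownianWithDrift X B G μ) {u : ℝ} (hu : 0 ≤ u) :
    Measurable[G u] (girsanovDensity X B u) := by
  have hX := h.drift u hu
  have hB := h.adapted u hu
  exact (Real.measurable_exp.comp ((hX.neg.mul hB).sub
    (((hX.pow_const 2).div_const 2).mul_const u))).ennreal_ofReal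

lemma infoFiltration_le (h : IsBrownianWithDrift X B G μ) (t : ℝ) :
    infoFiltration X B t ≤ G t :=
  iSup₂_le fun s hs => (h.measurable_driftedPath hs.1).comap_le.trans (h.mono s t hs.1 hs.2)

/-- Under the Girsanov density the information process has independent Gaussian increments. -/
lemma lintegral_girsanovDensity_mul [IsProbabilityMeasure μ] (h : IsBrownianWithDrift X B G μ)
    {u v : ℝ} (hu : 0 ≤ u) (huv : u ≤ v) {Y : Ω → ℝ≥0∞} (hY : Measurable[G u] Y)
    {g : ℝ → ℝ≥0∞} (hg : Measurable g) :
    ∫⁻ ω, Y ω * girsanovDensity X B v ω * g (driftedPath X B v ω) ∂μ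
      = ∫⁻ ω, Y ω * girsanovDensity X B u ω *
          ∫⁻ y, g (driftedPath X B u ω + y) ∂gaussianReal 0 (v - u).toNNReal ∂μ := by
  have hcoe : (((v - u).toNNReal : ℝ≥0) : ℝ) = v - u := Real.coe_toNNReal _ (sub_nonneg.2 huv)
  have hZ : Measurable fun ω => B v ω - B u ω :=
    ((h.adapted v (hu.trans huv)).mono (h.le v (hu.trans huv)) le_rfl).sub
      ((h.adapted u hu).mono (h.le u hu) le_rfl)
  have hid : @Measurable Ω Ω mΩ (G u) id := fun A hA => h.le u hu A hA
  have hind : @IndepFun Ω Ω ℝ mΩ (G u) _ id (fun ω => B v ω - B u ω) μ := by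
    refine (@IndepFun_iff_Indep Ω Ω ℝ mΩ (G u) _ _ _ _).2 ?_
    rw [MeasurableSpace.comap_id]
    exact (h.indep u v hu huv).symm
  have key := @lintegral_girsanov_of_indepFun Ω Ω mΩ (G u) μ _ id hid _ hZ hind _
    (h.law u v hu huv) _ (hY.mul (h.measurable_girsanovDensity hu))
    X (driftedPath X B u)
    (h.drift u hu) (h.measurable_driftedPath hu) g hg
  simp only [id, hcoe, Pi.mul_apply] at key
  rw [← key]
  refine lintegral_congr fun ω => ?_
  rw [← mul_assoc, mul_assoc (Y ω) (girsanovDensity X B u ω)]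
  congr 2
  · rw [girsanovDensity, girsanovDensity, ← ENNReal.ofReal_mul (Real.exp_nonneg _),
      ← Real.exp_add]
    congr 2
    ring
  · simp only [driftedPath]
    ring_nf

/-- `Y` belongs to `G u` and, jointly with the information process at time `u`, is independent of
the drift under the Girsanov density. -/
def IndepOfDrift (X : Ω → ℝ) (B : ℝ → Ω → ℝ) (G : ℝ → MeasurableSpace Ω) (μ : Measure Ω)
    (u : ℝ) (Y : Ω → ℝ≥0∞) : Prop :=
  Measurable[G u] Y ∧ ∀ S : Set ℝ, MeasurableSet S → ∀ g : ℝ → ℝ≥0∞, Measurable g →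
    ∫⁻ ω, (X ⁻¹' S).indicator Y ω * girsanovDensity X B u ω * g (driftedPath X B u ω) ∂μ
      = μ (X ⁻¹' S) * ∫⁻ ω, Y ω * girsanovDensity X B u ω * g (driftedPath X B u ω) ∂μ

lemma indepOfDrift_zero [IsProbabilityMeasure μ] (h : IsBrownianWithDrift X B G μ) :
    IndepOfDrift X B G μ 0 1 := by
  refine ⟨@measurable_const _ _ _ (G 0) 1, fun S hS g hg => ?_⟩
  have hS' : MeasurableSet (X ⁻¹' S) := h.le 0 le_rfl _ (h.drift 0 le_rfl hS)
  simp only [girsanovDensity, driftedPath, h.zero]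
  simp only [mul_zero, sub_zero, Real.exp_zero, ENNReal.ofReal_one, mul_one, zero_mul, add_zero,
    Pi.one_apply, one_mul, lintegral_const, measure_univ]
  rw [lintegral_mul_const _ (measurable_one.indicator hS'), lintegral_indicator_one hS']

lemma IndepOfDrift.step [IsProbabilityMeasure μ] (h : IsBrownianWithDrift X B G μ)
    {u v : ℝ} (hu : 0 ≤ u) (huv : u ≤ v) {Y : Ω → ℝ≥0∞} (hY : IndepOfDrift X B G μ u Y)
    {f : ℝ → ℝ≥0∞} (hf : Measurable f) :
    IndepOfDrift X B G μ v (fun ω => Y ω * f (driftedPath X B u ω)) := by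
  have hYf : Measurable[G u] (fun ω => Y ω * f (driftedPath X B u ω)) :=
    hY.1.mul (hf.comp (h.measurable_driftedPath hu))
  refine ⟨hYf.mono (h.mono u v hu huv) le_rfl, fun S hS g hg => ?_⟩
  have hk : Measurable fun x => f x * ∫⁻ y, g (x + y) ∂gaussianReal 0 (v - u).toNNReal :=
    hf.mul (Measurable.lintegral_prod_right' (f := fun q : ℝ × ℝ => g (q.1 + q.2)) (by fun_prop))
  rw [h.lintegral_girsanovDensity_mul hu huv hYf hg,
    h.lintegral_girsanovDensity_mul hu huv
      (Y := (X ⁻¹' S).indicator fun ω => Y ω * f (driftedPath X B u ω))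
      (hYf.indicator (h.drift u hu hS)) hg]
  convert hY.2 S hS _ hk using 2
  · ext ω
    by_cases hω : ω ∈ X ⁻¹' S
    · simp only [Set.indicator_of_mem hω]; ring
    · simp only [Set.indicator_of_notMem hω, zero_mul]
  · congr 1
    ext ω
    ring

lemma indepOfDrift_prod [IsProbabilityMeasure μ] (h : IsBrownianWithDrift X B G μ)
    {f : ℝ → ℝ → ℝ≥0∞} (I : Finset ℝ) :
    (∀ i ∈ I, Measurable (f i)) → ∀ v, 0 ≤ v → (∀ i ∈ I, 0 ≤ i ∧ i ≤ v) →
      IndepOfDrift X B G μ v (fun ω => ∏ i ∈ I, f i (driftedPath X B i ω)) := by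
  induction I using Finset.induction_on_max with
  | empty =>
    intro _ v hv _
    simpa using IndepOfDrift.step h le_rfl hv h.indepOfDrift_zero (f := fun _ => 1)
      measurable_const
  | insert a I haI ih =>
    intro hf v hv hI
    have ha := hI a (Finset.mem_insert_self a I)
    have hnot : a ∉ I := fun hmem => lt_irrefl _ (haI a hmem)
    have := IndepOfDrift.step h ha.1 ha.2
      (ih (fun i hi => hf i (Finset.mem_insert_of_mem hi)) a ha.1
        fun i hi => ⟨(hI i (Finset.mem_insert_of_mem hi)).1, (haI i hi).le⟩)
      (hf a (Finset.mem_insert_self a I))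
    simpa only [Finset.prod_insert hnot, mul_comm] using this

lemma lintegral_girsanovDensity [IsProbabilityMeasure μ] (h : IsBrownianWithDrift X B G μ)
    {t : ℝ} (ht : 0 ≤ t) : ∫⁻ ω, girsanovDensity X B t ω ∂μ = 1 := by
  have := h.lintegral_girsanovDensity_mul le_rfl ht (Y := 1) (@measurable_const _ _ _ (G 0) 1)
    (g := fun _ => 1) measurable_const
  simpa [girsanovDensity, h.zero] using this

/-- Under the Girsanov density, the drift is independent of the observed path. -/
lemma setLIntegral_preimage_drift [IsProbabilityMeasure μ] (h : IsBrownianWithDrift X B G μ)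
    {t : ℝ} (ht : 0 ≤ t) {S : Set ℝ} (hS : MeasurableSet S) {Y : Ω → ℝ≥0∞}
    (hY : Measurable[infoFiltration X B t] Y) :
    ∫⁻ ω in X ⁻¹' S, girsanovDensity X B t ω * Y ω ∂μ
      = μ (X ⁻¹' S) * ∫⁻ ω, girsanovDensity X B t ω * Y ω ∂μ := by
  have hFG := h.infoFiltration_le t
  have hF : infoFiltration X B t ≤ mΩ := hFG.trans (h.le t ht)
  have hL : Measurable (girsanovDensity X B t) :=
    (h.measurable_girsanovDensity ht).mono (h.le t ht) le_rfl
  have hS' : MeasurableSet (X ⁻¹' S) := h.le 0 le_rfl _ (h.drift 0 le_rfl hS)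
  have hY' : Measurable Y := hY.mono hF le_rfl
  set Q := μ.withDensity (girsanovDensity X B t) with hQ
  set Q' := (μ.restrict (X ⁻¹' S)).withDensity (girsanovDensity X B t) with hQ'
  have hQfin : IsFiniteMeasure Q :=
    isFiniteMeasure_withDensity (by rw [h.lintegral_girsanovDensity ht]; simp)
  have hQ'fin : IsFiniteMeasure Q' :=
    isFiniteMeasure_withDensity
      (ne_top_of_le_ne_top (by rw [h.lintegral_girsanovDensity ht]; simp)
        (setLIntegral_le_lintegral (X ⁻¹' S) (girsanovDensity X B t)))
  have hbox : ∀ A ∈ piiUnionInter (fun s =>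
      {A | MeasurableSet[MeasurableSpace.comap (driftedPath X B s) Real.measurableSpace] A})
      (Set.Icc 0 t), Q' A = μ (X ⁻¹' S) * Q A := by
    rintro A ⟨I, hI, A', hA', rfl⟩
    choose! C hC hCA using hA'
    have hmeas : MeasurableSet (⋂ i ∈ I, A' i) := by
      refine Finset.measurableSet_biInter I fun i hi => ?_
      rw [← hCA i hi]
      exact ((h.measurable_driftedPath (hI hi).1).mono (h.le i (hI hi).1) le_rfl) (hC i hi)
    have key := (h.indepOfDrift_prod (f := fun i => (C i).indicator 1) I
      (fun i hi => measurable_one.indicator (hC i hi)) t ht fun i hi => hI hi).2 S hS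
      (fun _ => 1) measurable_const
    have hprod : (fun ω => ∏ i ∈ I, (C i).indicator (1 : ℝ → ℝ≥0∞) (driftedPath X B i ω))
        = (⋂ i ∈ I, A' i).indicator 1 := by
      ext ω
      by_cases hω : ω ∈ ⋂ i ∈ I, A' i
      · rw [Set.indicator_of_mem hω]
        refine Finset.prod_eq_one fun i hi => ?_
        have : ω ∈ A' i := Set.mem_iInter₂.1 hω i hi
        rw [← hCA i hi] at this
        exact Set.indicator_of_mem (s := C i) this 1
      · rw [Set.indicator_of_notMem hω]
        simp only [Set.mem_iInter, not_forall] at hω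
        obtain ⟨i, hi, hiA⟩ := hω
        rw [← hCA i hi] at hiA
        exact Finset.prod_eq_zero hi (Set.indicator_of_notMem (s := C i) hiA 1)
    rw [hprod] at key
    rw [hQ', hQ, withDensity_apply _ hmeas, withDensity_apply _ hmeas,
      Measure.restrict_restrict hmeas, ← lintegral_indicator hmeas,
      ← lintegral_indicator (hmeas.inter hS')]
    convert key using 2
    · ext ω
      by_cases h1 : ω ∈ X ⁻¹' S <;> by_cases h2 : ω ∈ ⋂ i ∈ I, A' i <;>
        simp only [Set.indicator, Set.mem_inter_iff, h1, h2, and_self, and_false, false_and,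
          if_true, if_false, Pi.one_apply, one_mul, mul_one, zero_mul]
    · congr 1
      ext ω
      by_cases h2 : ω ∈ ⋂ i ∈ I, A' i <;>
        simp only [Set.indicator, h2, if_true, if_false, Pi.one_apply, one_mul, mul_one, zero_mul]
  have htrim : Q'.trim hF = (μ (X ⁻¹' S) • Q).trim hF := by
    refine @ext_of_generate_finite Ω (infoFiltration X B t) _ _ _
      (generateFrom_piiUnionInter_measurableSet _ _).symm
      (isPiSystem_piiUnionInter _ (fun s => @MeasurableSpace.isPiSystem_measurableSet _ (_)) _)
      (isFiniteMeasure_trim hF) (fun A hA => ?_) ?_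
    · have hAm : MeasurableSet[infoFiltration X B t] A :=
        measurableSet_iSup_of_mem_piiUnionInter _ _ _ hA
      rw [trim_measurableSet_eq hF hAm, trim_measurableSet_eq hF hAm, hbox A hA,
        Measure.smul_apply, smul_eq_mul]
    · have := hbox Set.univ ⟨∅, by simp, fun _ => Set.univ, by simp, by simp⟩
      rw [trim_measurableSet_eq hF MeasurableSet.univ, trim_measurableSet_eq hF MeasurableSet.univ,
        this, Measure.smul_apply, smul_eq_mul]
  have := lintegral_trim (μ := Q') hF hY
  rw [htrim, lintegral_trim hF hY, lintegral_smul_measure, hQ, hQ',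
    lintegral_withDensity_eq_lintegral_mul _ hL hY',
    lintegral_withDensity_eq_lintegral_mul _ hL hY'] at this
  exact this.symm

/-- **Bayes' formula** for a drift with finitely many values: an observed quantity is integrated
against `μ` by multiplying it with the likelihood mixture under the Girsanov density. -/
lemma lintegral_eq_lintegral_girsanovDensity_mul_sum {ι : Type*} [Fintype ι]
    [IsProbabilityMeasure μ] (h : IsBrownianWithDrift X B G μ) {a : ι → ℝ}
    (ha : Function.Injective a) (hXa : ∀ ω, ∃ r, X ω = a r) {t : ℝ} (ht : 0 ≤ t)
    {Y : Ω → ℝ≥0∞} (hY : Measurable[infoFiltration X B t] Y) :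
    ∫⁻ ω, Y ω ∂μ = ∫⁻ ω, girsanovDensity X B t ω * ((∑ r, μ (X ⁻¹' {a r}) *
      ENNReal.ofReal (Real.exp (a r * driftedPath X B t ω - a r ^ 2 / 2 * t))) * Y ω) ∂μ := by
  have hF : infoFiltration X B t ≤ mΩ := (h.infoFiltration_le t).trans (h.le t ht)
  have hL : Measurable (girsanovDensity X B t) :=
    (h.measurable_girsanovDensity ht).mono (h.le t ht) le_rfl
  have hX : Measurable X := (h.drift 0 le_rfl).mono (h.le 0 le_rfl) le_rfl
  have hSr : ∀ r, MeasurableSet (X ⁻¹' {a r}) := fun r => hX (measurableSet_singleton _)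
  have hY' : Measurable Y := hY.mono hF le_rfl
  have hξ : Measurable[infoFiltration X B t] (driftedPath X B t) :=
    (comap_measurable _).mono (le_iSup₂_of_le t ⟨ht, le_rfl⟩ le_rfl) le_rfl
  have hW : ∀ r, Measurable[infoFiltration X B t] fun ω =>
      ENNReal.ofReal (Real.exp (a r * driftedPath X B t ω - a r ^ 2 / 2 * t)) * Y ω := fun r =>
    (Real.measurable_exp.comp ((hξ.const_mul _).sub_const _)).ennreal_ofReal.mul hY
  have hcover : (⋃ r, X ⁻¹' {a r}) = Set.univ := by
    ext ω
    simpa using hXa ω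
  have hdisj : Pairwise (Function.onFun Disjoint fun r => X ⁻¹' {a r}) := fun r q hrq =>
    Disjoint.preimage X (Set.disjoint_singleton.2 fun hh => hrq (ha hh))
  have hright : ∀ ω, girsanovDensity X B t ω * ((∑ r, μ (X ⁻¹' {a r}) *
      ENNReal.ofReal (Real.exp (a r * driftedPath X B t ω - a r ^ 2 / 2 * t))) * Y ω)
      = ∑ r, μ (X ⁻¹' {a r}) * (girsanovDensity X B t ω * (ENNReal.ofReal
        (Real.exp (a r * driftedPath X B t ω - a r ^ 2 / 2 * t)) * Y ω)) := fun ω => by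
    rw [Finset.sum_mul, Finset.mul_sum]
    exact Finset.sum_congr rfl fun r _ => by ring
  have hLW : ∀ r, Measurable fun ω => girsanovDensity X B t ω * (ENNReal.ofReal
      (Real.exp (a r * driftedPath X B t ω - a r ^ 2 / 2 * t)) * Y ω) := fun r =>
    hL.mul ((hW r).mono hF le_rfl)
  simp_rw [hright]
  rw [lintegral_finsetSum _ fun r _ => (hLW r).const_mul _,
    ← setLIntegral_univ, ← hcover, lintegral_iUnion hSr hdisj, tsum_fintype]
  refine Finset.sum_congr rfl fun r _ => ?_
  rw [lintegral_const_mul _ (hLW r),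
    ← h.setLIntegral_preimage_drift ht (measurableSet_singleton _) (hW r)]
  refine setLIntegral_congr_fun (hSr r) fun ω hω => ?_
  have hω' : X ω = a r := hω
  simp only [girsanovDensity, driftedPath, hω']
  rw [← mul_assoc, ← ENNReal.ofReal_mul (Real.exp_nonneg _), ← Real.exp_add]
  rw [show -a r * B t ω - a r ^ 2 / 2 * t + (a r * (t * a r + B t ω) - a r ^ 2 / 2 * t) = 0 by
    ring]
  simp

/-- If multiplying `φ` by the likelihood mixture gives `exp (b * x - c * u)`, then `φ` evaluated
along the information process is, up to a deterministic exponential factor, a martingale. -/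
lemma setLIntegral_driftedPath_eq {ι : Type*} [Fintype ι] [IsProbabilityMeasure μ]
    (h : IsBrownianWithDrift X B G μ) {a : ι → ℝ} (ha : Function.Injective a)
    (hXa : ∀ ω, ∃ r, X ω = a r) {φ : ℝ → ℝ → ℝ≥0∞} (hφ : ∀ u, Measurable (φ u)) {b c : ℝ}
    (hbc : ∀ u x, (∑ r, μ (X ⁻¹' {a r}) *
      ENNReal.ofReal (Real.exp (a r * x - a r ^ 2 / 2 * u))) * φ u x
        = ENNReal.ofReal (Real.exp (b * x - c * u)))
    {s t : ℝ} (hs : 0 ≤ s) (hst : s ≤ t) {A : Set Ω}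
    (hA : MeasurableSet[infoFiltration X B s] A) :
    ∫⁻ ω in A, φ t (driftedPath X B t ω) ∂μ
      = ENNReal.ofReal (Real.exp ((b ^ 2 / 2 - c) * (t - s))) *
          ∫⁻ ω in A, φ s (driftedPath X B s ω) ∂μ := by
  have ht : 0 ≤ t := hs.trans hst
  have hAG : MeasurableSet[G s] A := h.infoFiltration_le s A hA
  have hA' : MeasurableSet A := h.le s hs A hAG
  have hbayes : ∀ u, s ≤ u → ∫⁻ ω in A, φ u (driftedPath X B u ω) ∂μ
      = ∫⁻ ω, A.indicator 1 ω * girsanovDensity X B u ω *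
          ENNReal.ofReal (Real.exp (b * driftedPath X B u ω - c * u)) ∂μ := fun u hsu => by
    have hξ : Measurable[infoFiltration X B u] (driftedPath X B u) :=
      (comap_measurable _).mono (le_iSup₂_of_le u ⟨hs.trans hsu, le_rfl⟩ le_rfl) le_rfl
    have hAu : MeasurableSet[infoFiltration X B u] A :=
      (biSup_mono fun i hi => ⟨hi.1, hi.2.trans hsu⟩ :
        infoFiltration X B s ≤ infoFiltration X B u) A hA
    rw [← lintegral_indicator hA',
      h.lintegral_eq_lintegral_girsanovDensity_mul_sum ha hXa (hs.trans hsu)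
        (Y := A.indicator fun ω => φ u (driftedPath X B u ω))
        (((hφ u).comp hξ).indicator hAu)]
    refine lintegral_congr fun ω => ?_
    by_cases hω : ω ∈ A
    · simp only [Set.indicator_of_mem hω, hbc, Pi.one_apply, one_mul]
    · simp only [Set.indicator_of_notMem hω, mul_zero, zero_mul]
  rw [hbayes t hst, hbayes s le_rfl,
    h.lintegral_girsanovDensity_mul hs hst (Y := A.indicator 1)
      ((@measurable_const _ _ _ (G s) 1).indicator hAG)
      (g := fun x => ENNReal.ofReal (Real.exp (b * x - c * t))) (by fun_prop),
    ← lintegral_const_mul' _ _ ENNReal.ofReal_ne_top]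
  refine lintegral_congr fun ω => ?_
  rw [mul_left_comm]
  congr 1
  rw [← ENNReal.ofReal_mul (Real.exp_nonneg _), ← Real.exp_add]
  have hexp : ∀ y, b * (driftedPath X B s ω + y) - c * t
      = b * y + (b * driftedPath X B s ω - c * t) := fun y => by ring
  simp_rw [hexp]
  rw [lintegral_exp_gaussianReal, Real.coe_toNNReal _ (sub_nonneg.2 hst)]
  congr 2
  ring

end IsBrownianWithDrift

/-- Process filtering: the decoherence factor `Φ_{nm}(t, ξ_t)` satisfies
`E[Φ_{nm}(t,ξ_t) | 𝓕_s] = exp(−σ²(Eₙ−Eₘ)²(t−s)/8) Φ_{nm}(s,ξ_s)`; in particular,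
for `n ≠ m` it is a strictly positive supermartingale whose expectation tends to
`0`, i.e. a potential. -/
theorem decoherence_factor_is_potential
    {Ω : Type*} [MeasureSpace Ω] (hP : IsProbabilityMeasure (ℙ : Measure Ω))
    (D : ℕ) (hD : 1 ≤ D) (E : Fin D → ℝ) (hE : Function.Injective E)
    (σ : ℝ) (hσ : 0 < σ)
    (H : Ω → ℝ) (hH : Measurable H) (hHval : ∀ ω, ∃ r, H ω = E r)
    (p : Fin D → ℝ) (hp : ∀ r, p r = ((ℙ : Measure Ω) {ω | H ω = E r}).toReal)
    (B : ℝ → Ω → ℝ) (hBmeas : ∀ s, Measurable (B s)) (hB0 : ∀ ω, B 0 ω = 0)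
    (hBlaw : ∀ s t : ℝ, 0 ≤ s → s ≤ t →
      Measure.map (fun ω => B t ω - B s ω) (ℙ : Measure Ω)
        = gaussianReal 0 (t - s).toNNReal)
    (hBindep : ∀ s t : ℝ, 0 ≤ s → s ≤ t →
      Indep (MeasurableSpace.comap (fun ω => B t ω - B s ω) Real.measurableSpace)
        (MeasurableSpace.comap H Real.measurableSpace ⊔
          ⨆ u ∈ Set.Icc (0 : ℝ) s, MeasurableSpace.comap (B u) Real.measurableSpace)
        (ℙ : Measure Ω))
    (ξ : ℝ → Ω → ℝ) (hξ : ∀ s ω, ξ s ω = σ * s * H ω + B s ω)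
    (F : ℝ → MeasurableSpace Ω)
    (hF : ∀ t, F t =
      ⨆ s ∈ Set.Icc (0 : ℝ) t, MeasurableSpace.comap (ξ s) Real.measurableSpace)
    (Φ : Fin D → Fin D → ℝ → ℝ → ℝ)
    (hΦ : ∀ n m s x, Φ n m s x =
      Real.exp (σ / 2 * (E n + E m) * x - σ ^ 2 / 4 * ((E n) ^ 2 + (E m) ^ 2) * s) /
        ∑ r, p r * Real.exp (σ * E r * x - σ ^ 2 / 2 * (E r) ^ 2 * s))
    (n m : Fin D) :
    (∀ s t : ℝ, 0 ≤ s → s ≤ t →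
      (ℙ : Measure Ω)[(fun ω => Φ n m t (ξ t ω)) | F s]
        =ᵐ[(ℙ : Measure Ω)] fun ω =>
          Real.exp (-(σ ^ 2 / 8) * (E n - E m) ^ 2 * (t - s)) * Φ n m s (ξ s ω))
    ∧ (n ≠ m →
        (∀ t : ℝ, ∀ ω : Ω, 0 < Φ n m t (ξ t ω))
        ∧ Tendsto (fun t => ∫ ω, Φ n m t (ξ t ω) ∂(ℙ : Measure Ω)) atTop (nhds 0)) := by
  set X : Ω → ℝ := fun ω => σ * H ω with hX
  set a : Fin D → ℝ := fun r => σ * E r with ha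
  set G : ℝ → MeasurableSpace Ω := fun s => MeasurableSpace.comap H Real.measurableSpace ⊔
    ⨆ u ∈ Set.Icc (0 : ℝ) s, MeasurableSpace.comap (B u) Real.measurableSpace
  have hBD : IsBrownianWithDrift X B G ℙ :=
    { le := fun u _ => sup_le hH.comap_le (iSup₂_le fun i _ => (hBmeas i).comap_le)
      mono := fun u v _ huv => sup_le_sup_left
        (biSup_mono fun i (hi : i ∈ Set.Icc 0 u) => Set.Icc_subset_Icc_right huv hi) _
      drift := fun u _ => ((comap_measurable H).mono le_sup_left le_rfl).const_mul σ
      adapted := fun u hu => (comap_measurable (B u)).mono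
        (le_sup_of_le_right (le_iSup₂_of_le u ⟨hu, le_rfl⟩ le_rfl)) le_rfl
      zero := hB0
      law := hBlaw
      indep := hBindep }
  have haI : Function.Injective a := fun r q hrq => hE (mul_left_cancel₀ hσ.ne' hrq)
  have hXa : ∀ ω, ∃ r, X ω = a r := fun ω => (hHval ω).imp fun r hr => by simp [hX, ha, hr]
  have hξI : ξ = driftedPath X B := by
    ext s ω
    rw [hξ, driftedPath]
    ring
  have hFI : ∀ t, F t = infoFiltration X B t := fun t => by rw [hF, hξI]
  have hpre : ∀ r, X ⁻¹' {a r} = {ω | H ω = E r} := fun r => by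
    ext ω
    simp [hX, ha, hσ.ne']
  have hpX : ∀ r, (ℙ : Measure Ω) (X ⁻¹' {a r}) = ENNReal.ofReal (p r) := fun r => by
    rw [hpre, hp, ENNReal.ofReal_toReal (measure_ne_top _ _)]
  have hp0 : ∀ r, 0 ≤ p r := fun r => by rw [hp]; exact ENNReal.toReal_nonneg
  have hpsum : ∑ r, p r = 1 := by
    have hcover : (⋃ r, {ω | H ω = E r}) = Set.univ := by
      ext ω
      simpa using hHval ω
    have hdisj : Pairwise (Function.onFun Disjoint fun r => {ω | H ω = E r}) := fun r q hrq =>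
      Set.disjoint_left.2 fun ω h1 h2 => hrq (hE (h1.symm.trans h2))
    have hmeas : ∀ r, MeasurableSet {ω | H ω = E r} := fun r => hH (measurableSet_singleton (E r))
    have hsum := measure_iUnion (μ := (ℙ : Measure Ω)) hdisj hmeas
    rw [hcover, measure_univ, tsum_fintype] at hsum
    simp_rw [hp]
    rw [← ENNReal.toReal_sum fun r _ => measure_ne_top _ _, ← hsum, ENNReal.toReal_one]
  have hZpos : ∀ u x : ℝ, 0 < ∑ r, p r * Real.exp (σ * E r * x - σ ^ 2 / 2 * (E r) ^ 2 * u) := by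
    intro u x
    obtain ⟨r, -, hr⟩ := Finset.exists_ne_zero_of_sum_ne_zero (hpsum.trans_ne one_ne_zero)
    exact Finset.sum_pos' (fun q _ => mul_nonneg (hp0 q) (Real.exp_nonneg _))
      ⟨r, Finset.mem_univ r, mul_pos ((hp0 r).lt_of_ne hr.symm) (Real.exp_pos _)⟩
  have hΦpos : ∀ u x, 0 < Φ n m u x := fun u x => by
    rw [hΦ]
    exact div_pos (Real.exp_pos _) (hZpos u x)
  have hΦmeas : ∀ u, Measurable (Φ n m u) := fun u => by
    rw [funext (hΦ n m u)]
    fun_prop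
  have hbc : ∀ u x, (∑ r, (ℙ : Measure Ω) (X ⁻¹' {a r}) *
      ENNReal.ofReal (Real.exp (a r * x - a r ^ 2 / 2 * u))) * ENNReal.ofReal (Φ n m u x)
      = ENNReal.ofReal (Real.exp (σ / 2 * (E n + E m) * x
          - σ ^ 2 / 4 * ((E n) ^ 2 + (E m) ^ 2) * u)) := fun u x => by
    have hterm : ∀ r, (ℙ : Measure Ω) (X ⁻¹' {a r}) *
        ENNReal.ofReal (Real.exp (a r * x - a r ^ 2 / 2 * u))
        = ENNReal.ofReal (p r * Real.exp (σ * E r * x - σ ^ 2 / 2 * (E r) ^ 2 * u)) := fun r => by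
      rw [hpX, ← ENNReal.ofReal_mul (hp0 r)]
      congr 3
      simp only [ha]
      ring
    simp_rw [hterm]
    rw [← ENNReal.ofReal_sum_of_nonneg fun r _ => mul_nonneg (hp0 r) (Real.exp_nonneg _),
      ← ENNReal.ofReal_mul (hZpos u x).le, hΦ, mul_div_cancel₀ _ (hZpos u x).ne']
  have hkey : ∀ s t : ℝ, 0 ≤ s → s ≤ t → ∀ A, MeasurableSet[F s] A →
      ∫⁻ ω in A, ENNReal.ofReal (Φ n m t (ξ t ω)) ∂(ℙ : Measure Ω)
        = ENNReal.ofReal (Real.exp (-(σ ^ 2 / 8) * (E n - E m) ^ 2 * (t - s))) *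
          ∫⁻ ω in A, ENNReal.ofReal (Φ n m s (ξ s ω)) ∂(ℙ : Measure Ω) := by
    intro s t hs hst A hA
    rw [hFI] at hA
    rw [hξI, hBD.setLIntegral_driftedPath_eq haI hXa
      (φ := fun u x => ENNReal.ofReal (Φ n m u x)) (fun u => (hΦmeas u).ennreal_ofReal)
      hbc hs hst hA]
    congr 3
    ring
  have hξmeas : ∀ t, Measurable (ξ t) := fun t => by
    rw [funext (hξ t)]
    exact (hH.const_mul _).add (hBmeas t)
  have hΦξmeas : ∀ t, Measurable fun ω => Φ n m t (ξ t ω) := fun t =>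
    (hΦmeas t).comp (hξmeas t)
  have htotal : ∀ t, 0 ≤ t → ∫⁻ ω, ENNReal.ofReal (Φ n m t (ξ t ω)) ∂(ℙ : Measure Ω)
      = ENNReal.ofReal (Real.exp (-(σ ^ 2 / 8) * (E n - E m) ^ 2 * t)) := by
    intro t ht
    have h0 := hkey 0 t le_rfl ht Set.univ MeasurableSet.univ
    have hξ0 : ∀ ω, ξ 0 ω = 0 := fun ω => by simp [hξ, hB0]
    simpa [hξ0, hΦ n m 0 0, hpsum] using h0
  have hΦint : ∀ t, 0 ≤ t → Integrable (fun ω => Φ n m t (ξ t ω)) (ℙ : Measure Ω) := by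
    intro t ht
    refine ⟨(hΦξmeas t).aestronglyMeasurable, ?_⟩
    rw [hasFiniteIntegral_iff_ofReal (Eventually.of_forall fun ω => (hΦpos t _).le), htotal t ht]
    exact ENNReal.ofReal_lt_top
  refine ⟨fun s t hs hst => ?_, fun hnm => ⟨fun t ω => hΦpos t _, ?_⟩⟩
  · have hFle : F s ≤ MeasureSpace.toMeasurableSpace := by
      rw [hF]
      exact iSup₂_le fun i _ => (hξmeas i).comap_le
    have hξF : Measurable[F s] (ξ s) := by
      rw [hF]
      exact (comap_measurable (ξ s)).mono (le_iSup₂_of_le s ⟨hs, le_rfl⟩ le_rfl) le_rfl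
    refine (ae_eq_condExp_of_forall_setIntegral_eq hFle (hΦint t (hs.trans hst))
      (fun A _ _ => ((hΦint s hs).const_mul _).integrableOn) (fun A hA _ => ?_)
      (((hΦmeas s).comp hξF).const_mul _).stronglyMeasurable.aestronglyMeasurable).symm
    rw [integral_const_mul,
      integral_eq_lintegral_of_nonneg_ae (Eventually.of_forall fun ω => (hΦpos t _).le)
        (hΦξmeas t).aestronglyMeasurable,
      integral_eq_lintegral_of_nonneg_ae (Eventually.of_forall fun ω => (hΦpos s _).le)
        (hΦξmeas s).aestronglyMeasurable,
      hkey s t hs hst A hA, ENNReal.toReal_mul, ENNReal.toReal_ofReal (Real.exp_nonneg _)]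
  · have hrate : 0 < σ ^ 2 / 8 * (E n - E m) ^ 2 := by
      have : E n - E m ≠ 0 := sub_ne_zero.2 (hE.ne hnm)
      positivity
    have hlim : Tendsto (fun t : ℝ => Real.exp (-(σ ^ 2 / 8) * (E n - E m) ^ 2 * t)) atTop
        (nhds 0) := by
      refine Real.tendsto_exp_atBot.comp (tendsto_id.const_mul_atTop_of_neg ?_)
      linarith
    refine hlim.congr' ((eventually_ge_atTop 0).mono fun t ht => ?_)
    dsimp only
    rw [integral_eq_lintegral_of_nonneg_ae (Eventually.of_forall fun ω => (hΦpos t _).le)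
      (hΦξmeas t).aestronglyMeasurable, htotal t ht, ENNReal.toReal_ofReal (Real.exp_nonneg _)]
end
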